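/- Let H, G be real Hilbert spaces, f ∈ Γ₀(H), g ∈ Γ₀(G), L : H → G bounded linear, with 0 ∈ sri(L*(dom g*) − dom f*). Then ∂((L ▷ f) □ g) = (L ▷ ∂f) □ ∂g, where on the left ▷ and □ denote infimal postcomposition and infimal convolution of functions, and on the right they denote parallel composition and parallel sum of set-valued operators. -/

import Mathlib

open scoped Pointwise RealInnerProductSpace

noncomputable section

/-- Inverse of a set-valued operator (graph reversal). -/
def SVInv {α β : Type*} (A : α → Set β) : β → Set α := fun u => {x | u ∈ A x}

/-- Range of a set-valued operator. -/
def SVRan {α β : Type*} (A : α → Set β) : Set β := ⋃ x, A x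

/-- Parallel sum of set-valued operators: `A □ B = (A⁻¹ + B⁻¹)⁻¹`. -/
def parSum {α : Type*} [Add α] (A B : α → Set α) : α → Set α :=
  SVInv fun u => SVInv A u + SVInv B u

/-- Parallel composition of `A` by `L`: `L ▷ A = (L ∘ A⁻¹ ∘ L*)⁻¹`. -/
def parComp {H G : Type*} [NormedAddCommGroup H] [InnerProductSpace ℝ H] [CompleteSpace H]
    [NormedAddCommGroup G] [InnerProductSpace ℝ G] [CompleteSpace G]
    (L : H →L[ℝ] G) (A : H → Set H) : G → Set G :=
  SVInv fun v => L '' SVInv A (ContinuousLinearMap.adjoint L v)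

/-- Monotonicity of a set-valued operator. -/
def IsMonotoneOp {H : Type*} [NormedAddCommGroup H] [InnerProductSpace ℝ H]
    (A : H → Set H) : Prop :=
  ∀ x y u v, u ∈ A x → v ∈ A y → (0:ℝ) ≤ ⟪x - y, u - v⟫

/-- Maximal monotonicity: no monotone operator has a strictly larger graph. -/
def IsMaxMonotoneOp {H : Type*} [NormedAddCommGroup H] [InnerProductSpace ℝ H]
    (A : H → Set H) : Prop :=
  IsMonotoneOp A ∧ ∀ B : H → Set H, IsMonotoneOp B → (∀ x, A x ⊆ B x) → B = A

/-- The cone generated by a set. -/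
def coneGen {H : Type*} [AddCommGroup H] [Module ℝ H] (D : Set H) : Set H :=
  {z | ∃ c : ℝ, 0 ≤ c ∧ ∃ y ∈ D, z = c • y}

/-- The cone generated by `D` is a closed vector subspace. -/
def IsClosedSubspaceCone {H : Type*} [NormedAddCommGroup H] [Module ℝ H]
    (D : Set H) : Prop :=
  ∃ S : Submodule ℝ H, IsClosed (S : Set H) ∧ coneGen D = ↑S

/-- Effective domain of an `EReal`-valued function. -/
def effDom {H : Type*} (f : H → EReal) : Set H := {x | f x ≠ ⊤}

/-- Properness. -/
def ProperFn {H : Type*} (f : H → EReal) : Prop := (∀ x, f x ≠ ⊥) ∧ ∃ x, f x ≠ ⊤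

/-- Convexity for `EReal`-valued functions. -/
def ConvexERealFn {H : Type*} [AddCommGroup H] [Module ℝ H] (f : H → EReal) : Prop :=
  ∀ x y : H, ∀ a b : ℝ, 0 ≤ a → 0 ≤ b → a + b = 1 →
    f (a • x + b • y) ≤ (a : EReal) * f x + (b : EReal) * f y

/-- The class `Γ₀`: proper, convex, lower semicontinuous. -/
def IsGamma0 {H : Type*} [NormedAddCommGroup H] [NormedSpace ℝ H] (f : H → EReal) : Prop :=
  ProperFn f ∧ ConvexERealFn f ∧ LowerSemicontinuous f

/-- Fenchel conjugate. -/
def fconj {H : Type*} [NormedAddCommGroup H] [InnerProductSpace ℝ H]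
    (f : H → EReal) (u : H) : EReal :=
  ⨆ x, ((⟪x, u⟫ : ℝ) : EReal) - f x

/-- Infimal convolution. -/
def infConv {H : Type*} [Sub H] (f g : H → EReal) (x : H) : EReal := ⨅ y, f (x - y) + g y

/-- Infimal postcomposition `(L ▷ f)(y) = inf {f x : L x = y}`. -/
def infPost {H G : Type*} [NormedAddCommGroup H] [NormedSpace ℝ H]
    [NormedAddCommGroup G] [NormedSpace ℝ G]
    (L : H →L[ℝ] G) (f : H → EReal) (y : G) : EReal :=
  ⨅ x : {x : H // L x = y}, f x.1

/-- Convex subdifferential of an `EReal`-valued function. -/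
def subdiffFn {H : Type*} [NormedAddCommGroup H] [InnerProductSpace ℝ H]
    (f : H → EReal) (x : H) : Set H :=
  {u | ∀ y, f x + ((⟪y - x, u⟫ : ℝ) : EReal) ≤ f y}

/-- `x` belongs to the strong relative interior of `C`. -/
def sriMem {H : Type*} [NormedAddCommGroup H] [Module ℝ H] (C : Set H) (x : H) : Prop :=
  x ∈ C ∧ IsClosedSubspaceCone ((fun y => y - x) '' C)


/-- A function which is nowhere `⊥` has a finite conjugate at `q` iff it admits an affine minorant
with slope `q`. -/
theorem mem_effDom_fconj_iff {E : Type*} [NormedAddCommGroup E] [InnerProductSpace ℝ E]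
    {f : E → EReal} (hf : ∀ x, f x ≠ ⊥) {q : E} :
    q ∈ effDom (fconj f) ↔ ∃ c : ℝ, ∀ (x : E) (t : ℝ), f x ≤ t → ⟪x, q⟫ - t ≤ c := by
  constructor
  · intro h
    obtain ⟨c, hc, -⟩ := EReal.lt_iff_exists_real_btwn.1 (lt_top_iff_ne_top.2 h)
    refine ⟨c, fun x t hx => ?_⟩
    have h1 : ((⟪x, q⟫ : ℝ) : EReal) - f x ≤ c :=
      (le_iSup (fun x => ((⟪x, q⟫ : ℝ) : EReal) - f x) x).trans hc.le
    have h2 := (EReal.sub_le_sub (le_refl ((⟪x, q⟫ : ℝ) : EReal)) hx).trans h1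
    exact_mod_cast h2
  · rintro ⟨c, hc⟩
    refine ne_top_of_le_ne_top (EReal.coe_ne_top c) (iSup_le fun x => ?_)
    have h0 := hf x
    have h1 := hc x
    induction h : f x with
    | bot => exact absurd h h0
    | top => simp
    | coe r => exact_mod_cast h1 r h.le

theorem ConvexERealFn.le_coe_combo {E : Type*} [AddCommGroup E] [Module ℝ E] {f : E → EReal}
    (hf : ConvexERealFn f) {x y : E} {s t a b : ℝ} (hx : f x ≤ s) (hy : f y ≤ t)
    (ha : 0 ≤ a) (hb : 0 ≤ b) (hab : a + b = 1) : f (a • x + b • y) ≤ (a * s + b * t : ℝ) := by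
  refine (hf x y a b ha hb hab).trans ?_
  push_cast
  exact add_le_add (mul_le_mul_of_nonneg_left hx (by exact_mod_cast ha))
    (mul_le_mul_of_nonneg_left hy (by exact_mod_cast hb))

theorem EReal.add_le_coe_iff {x y : EReal} (hx : x ≠ ⊥) (hy : y ≠ ⊥) {c : ℝ} :
    x + y ≤ c ↔ ∃ s t : ℝ, x ≤ s ∧ y ≤ t ∧ s + t ≤ c := by
  constructor
  · intro h
    induction x with
    | bot => exact absurd rfl hx
    | top => simp [EReal.top_add_of_ne_bot hy] at h
    | coe s =>
      induction y with
      | bot => exact absurd rfl hy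
      | top => simp at h
      | coe t => exact ⟨s, t, le_rfl, le_rfl, by exact_mod_cast h⟩
  · rintro ⟨s, t, hs, ht, hc⟩
    exact (add_le_add hs ht).trans (by exact_mod_cast hc)

/-- If `dom f*` lies in the affine hyperplane through `q₀` orthogonal to `w`, then `f` grows at most
linearly, with slope `q₀`, in the direction `w`. -/
theorem IsGamma0.add_le_of_inner_eq_zero {E : Type*} [NormedAddCommGroup E]
    [InnerProductSpace ℝ E] [CompleteSpace E] {f : E → EReal} (hf : IsGamma0 f) {q₀ w : E}
    (hq₀ : q₀ ∈ effDom (fconj f)) (hw : ∀ q ∈ effDom (fconj f), ⟪q - q₀, w⟫ = 0)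
    {x : E} {r : ℝ} (hx : f x ≤ r) : f (x + w) ≤ (r + ⟪q₀, w⟫ : ℝ) := by
  obtain ⟨⟨hbot, -⟩, hconv, hlsc⟩ := hf
  by_contra hcon
  let epi : Set (E × ℝ) := {p | f p.1 ≤ (p.2 : EReal)}
  have hclosed : IsClosed epi :=
    hlsc.isClosed_epigraph.preimage
      (f := fun p : E × ℝ => (p.1, (p.2 : EReal)))
      (continuous_fst.prodMk (continuous_coe_real_ereal.comp continuous_snd))
  have hcvx : Convex ℝ epi := fun p hp q hq a b ha hb hab =>
    hconv.le_coe_combo (s := p.2) (t := q.2) hp hq ha hb hab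
  obtain ⟨φ, α, hlt, hge⟩ := geometric_hahn_banach_point_closed (x := (x + w, r + ⟪q₀, w⟫))
    hcvx hclosed hcon
  let u : E := (InnerProductSpace.toDual ℝ E).symm (φ.comp (ContinuousLinearMap.inl ℝ E ℝ))
  let s : ℝ := φ (0, 1)
  have hφ : ∀ y t, φ (y, t) = ⟪u, y⟫ + s * t := by
    intro y t
    have h1 : ⟪u, y⟫ = φ (y, 0) := by simp [u]
    have h2 : s * t = φ (0, t) := by
      rw [mul_comm, ← smul_eq_mul, ← map_smul]; simp
    rw [h1, h2, ← map_add]; simp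
  have hge' : ∀ y (t : ℝ), f y ≤ t → α < ⟪u, y⟫ + s * t := fun y t h => by
    rw [← hφ]; exact hge (y, t) h
  rw [hφ] at hlt
  have hs : 0 ≤ s := by
    by_contra! hs
    have h1 := hge' x (r + |(⟪u, x⟫ + s * r - α) / s|)
      (hx.trans (by exact_mod_cast le_add_of_nonneg_right (abs_nonneg _)))
    have h2 := neg_le_abs ((⟪u, x⟫ + s * r - α) / s)
    have h3 := mul_le_mul_of_nonpos_left h2 hs.le
    rw [mul_neg, mul_div_cancel₀ _ hs.ne] at h3
    linarith
  have hs1 : 0 < s + 1 := by linarith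
  obtain ⟨c, hc⟩ := (mem_effDom_fconj_iff hbot).1 hq₀
  have hmem : (s + 1)⁻¹ • (q₀ - u) ∈ effDom (fconj f) := by
    refine (mem_effDom_fconj_iff hbot).2 ⟨(s + 1)⁻¹ * (c - α), fun y t hy => ?_⟩
    have h1 := hc y t hy
    have h2 := hge' y t hy
    rw [real_inner_comm] at h2
    have h3 : ⟪y, (s + 1)⁻¹ • (q₀ - u)⟫ - t = (s + 1)⁻¹ * (⟪y, q₀⟫ - ⟪y, u⟫ - (s + 1) * t) := by
      rw [inner_smul_right, inner_sub_right]; field_simp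
    rw [h3]
    exact mul_le_mul_of_nonneg_left (by linarith) (by positivity)
  have h0 := hw _ hmem
  rw [inner_sub_left, inner_smul_left, inner_sub_left] at h0
  have h1 : ⟪q₀, w⟫ - ⟪u, w⟫ = (s + 1) * ⟪q₀, w⟫ := by
    simp only [conj_trivial] at h0
    field_simp at h0
    linarith
  have h2 := hge' x r hx
  rw [inner_add_right] at hlt
  linarith

/-- Cantor's intersection property for bounded closed convex sets in a Hilbert space. -/
theorem nonempty_iInter_of_antitone_convex_bounded {E : Type*} [NormedAddCommGroup E]
    [InnerProductSpace ℝ E] [CompleteSpace E] {K : ℕ → Set E} (hanti : Antitone K)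
    (hne : ∀ n, (K n).Nonempty) (hclosed : ∀ n, IsClosed (K n)) (hconv : ∀ n, Convex ℝ (K n))
    {R : ℝ} (hbdd : ∀ x ∈ K 0, ‖x‖ ≤ R) : (⋂ n, K n).Nonempty := by
  have hmin : ∀ n, ∃ p ∈ K n, ∀ y ∈ K n, ⟪p, p⟫ ≤ ⟪p, y⟫ := by
    intro n
    obtain ⟨p, hp, hpmin⟩ :=
      exists_norm_eq_iInf_of_complete_convex (hne n) (hclosed n).isComplete (hconv n) 0
    refine ⟨p, hp, fun y hy => ?_⟩
    have h := (norm_eq_iInf_iff_real_inner_le_zero (hconv n) hp).1 hpmin y hy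
    rw [zero_sub, inner_neg_left, inner_sub_right] at h
    linarith
  choose p hpK hp using hmin
  have hdist : ∀ n m, n ≤ m → ‖p m - p n‖ ^ 2 ≤ ‖p m‖ ^ 2 - ‖p n‖ ^ 2 := by
    intro n m hnm
    have h := hp n (p m) (hanti hnm (hpK m))
    rw [real_inner_self_eq_norm_sq, real_inner_comm] at h
    rw [norm_sub_sq_real]
    linarith
  have hmono : Monotone fun n => ‖p n‖ ^ 2 := fun n m hnm => by
    have := hdist n m hnm
    have := sq_nonneg ‖p m - p n‖
    show ‖p n‖ ^ 2 ≤ ‖p m‖ ^ 2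
    linarith
  have hbound : BddAbove (Set.range fun n => ‖p n‖ ^ 2) := by
    refine ⟨R ^ 2, ?_⟩
    rintro _ ⟨n, rfl⟩
    exact pow_le_pow_left₀ (norm_nonneg _) (hbdd _ (hanti (Nat.zero_le n) (hpK n))) 2
  have hcau : CauchySeq p := by
    have hc := (tendsto_atTop_ciSup hmono hbound).cauchySeq
    rw [Metric.cauchySeq_iff'] at hc ⊢
    intro ε hε
    obtain ⟨N, hN⟩ := hc (ε ^ 2) (by positivity)
    refine ⟨N, fun n hn => ?_⟩
    have h1 := hN n hn
    rw [Real.dist_eq] at h1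
    rw [dist_eq_norm]
    exact lt_of_pow_lt_pow_left₀ 2 hε.le
      (((hdist N n hn).trans (le_abs_self _)).trans_lt h1)
  obtain ⟨x, hx⟩ := cauchySeq_tendsto_of_complete hcau
  refine ⟨x, Set.mem_iInter.2 fun n => (hclosed n).mem_of_tendsto hx ?_⟩
  filter_upwards [Filter.eventually_ge_atTop n] with m hm
  exact hanti hm (hpK m)

/-- A subset of a closed subspace `S` on which every functional `⟪·, y⟫`, `y ∈ S`, is bounded above
is norm bounded. -/
theorem exists_norm_le_of_inner_bddAbove {E : Type*} [NormedAddCommGroup E]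
    [InnerProductSpace ℝ E] [CompleteSpace E] {S : Submodule ℝ E} (hS : IsClosed (S : Set E))
    {K : Set E} (hKS : K ⊆ S) (hK : ∀ y ∈ S, ∃ C : ℝ, ∀ k ∈ K, ⟪k, y⟫ ≤ C) :
    ∃ R : ℝ, ∀ k ∈ K, ‖k‖ ≤ R := by
  have : CompleteSpace S := hS.completeSpace_coe
  obtain ⟨R, hR⟩ := banach_steinhaus (g := fun k : K => innerSL ℝ (k : E)) (by
    intro y
    obtain ⟨a, ha, b, hb, rfl⟩ := S.exists_add_mem_mem_orthogonal y
    obtain ⟨C₁, h₁⟩ := hK a ha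
    obtain ⟨C₂, h₂⟩ := hK (-a) (S.neg_mem ha)
    refine ⟨max C₁ C₂, fun k => ?_⟩
    have h0 : ⟪(k : E), b⟫ = 0 := Submodule.inner_right_of_mem_orthogonal (hKS k.2) hb
    have h₁' := h₁ k k.2
    have h₂' := h₂ k k.2
    rw [inner_neg_right] at h₂'
    rw [innerSL_apply_apply, inner_add_right, h0, add_zero, Real.norm_eq_abs]
    exact abs_le.2 ⟨by linarith [le_max_right C₁ C₂], h₁'.trans (le_max_left _ _)⟩)
  exact ⟨R, fun k hk => by simpa using hR ⟨k, hk⟩⟩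

/-- Under the qualification condition, `x ↦ f x + g (z - L x)` attains its infimum, provided this
infimum is finite. -/
theorem exists_add_le_of_sriMem {H G : Type*}
    [NormedAddCommGroup H] [InnerProductSpace ℝ H] [CompleteSpace H]
    [NormedAddCommGroup G] [InnerProductSpace ℝ G] [CompleteSpace G]
    {f : H → EReal} {g : G → EReal} {L : H →L[ℝ] G}
    (hf : IsGamma0 f) (hg : IsGamma0 g)
    (hq : sriMem (ContinuousLinearMap.adjoint L '' effDom (fconj g) - effDom (fconj f)) 0)
    {z : G} {m : ℝ} (hm : ∀ c : ℝ, m < c → ∃ x, f x + g (z - L x) ≤ c) :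
    ∃ x, f x + g (z - L x) ≤ m := by
  obtain ⟨h0, S, hS, hcone⟩ := hq
  simp only [sub_zero, Set.image_id'] at hcone
  have hsub : ∀ p ∈ effDom (fconj g), ∀ q ∈ effDom (fconj f),
      ContinuousLinearMap.adjoint L p - q ∈ S := by
    intro p hp q hq
    rw [← SetLike.mem_coe, ← hcone]
    exact ⟨1, zero_le_one, _, Set.sub_mem_sub ⟨p, hp, rfl⟩ hq, (one_smul ℝ _).symm⟩
  obtain ⟨_, ⟨p₀, hp₀, rfl⟩, q₀, hq₀, hpq⟩ := h0
  have hpq₀ : ContinuousLinearMap.adjoint L p₀ = q₀ := sub_eq_zero.1 hpq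
  have : CompleteSpace S := hS.completeSpace_coe
  let K : ℝ → Set H := fun c => {x | x ∈ S ∧ f x + g (z - L x) ≤ c}
  have hsplit : ∀ x (c : ℝ), f x + g (z - L x) ≤ c ↔
      ∃ s t : ℝ, f x ≤ s ∧ g (z - L x) ≤ t ∧ s + t ≤ c :=
    fun x c => EReal.add_le_coe_iff (hf.1.1 x) (hg.1.1 _)
  have hne : ∀ c, m < c → (K c).Nonempty := by
    intro c hc
    obtain ⟨x, hx⟩ := hm c hc
    obtain ⟨s, t, hs, ht, hst⟩ := (hsplit x c).1 hx
    obtain ⟨a, ha, b, hb, rfl⟩ := S.exists_add_mem_mem_orthogonal x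
    refine ⟨a, ha, (hsplit a c).2 ⟨s + ⟪q₀, -b⟫, t + ⟪p₀, L b⟫, ?_, ?_, ?_⟩⟩
    · have := hf.add_le_of_inner_eq_zero hq₀ (w := -b) (fun q hq => ?_) hs
      · simpa using this
      · refine Submodule.inner_right_of_mem_orthogonal (K := S) ?_ (Sᗮ.neg_mem hb)
        have := S.neg_mem (hsub p₀ hp₀ q hq)
        rwa [hpq₀, neg_sub] at this
    · have := hg.add_le_of_inner_eq_zero hp₀ (w := L b) (fun p hp => ?_) ht
      · convert this using 2
        rw [map_add]; abel
      · rw [← ContinuousLinearMap.adjoint_inner_left, map_sub, hpq₀]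
        exact Submodule.inner_right_of_mem_orthogonal (hsub p hp q₀ hq₀) hb
    · rw [← ContinuousLinearMap.adjoint_inner_left, hpq₀, inner_neg_right]
      linarith
  have hclosed : ∀ c, IsClosed (K c) := by
    intro c
    have hlsc : LowerSemicontinuous fun x => f x + g (z - L x) :=
      hf.2.2.add' (LowerSemicontinuous.comp hg.2.2 (by fun_prop : Continuous fun x => z - L x))
        fun x => EReal.continuousAt_add (Or.inr (hg.1.1 _)) (Or.inl (hf.1.1 _))
    exact hS.inter (hlsc.isClosed_preimage (c : EReal))
  have hconv : ∀ c, Convex ℝ (K c) := by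
    rintro c x ⟨hxS, hx⟩ y ⟨hyS, hy⟩ a b ha hb hab
    obtain ⟨s, t, hs, ht, hst⟩ := (hsplit x c).1 hx
    obtain ⟨s', t', hs', ht', hst'⟩ := (hsplit y c).1 hy
    refine ⟨S.convex hxS hyS ha hb hab, (hsplit _ c).2 ⟨_, a * t + b * t',
      hf.2.1.le_coe_combo hs hs' ha hb hab, ?_, ?_⟩⟩
    · have h := hg.2.1.le_coe_combo ht ht' ha hb hab
      have hz : z - L (a • x + b • y) = a • (z - L x) + b • (z - L y) := by
        rw [smul_sub, smul_sub, map_add, map_smul, map_smul]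
        nth_rewrite 1 [← one_smul ℝ z]
        rw [← hab, add_smul]; abel
      rwa [hz]
    · calc a * s + b * s' + (a * t + b * t') = a * (s + t) + b * (s' + t') := by ring
        _ ≤ a * c + b * c := by gcongr
        _ = c := by rw [← add_mul, hab, one_mul]
  obtain ⟨R, hR⟩ : ∃ R : ℝ, ∀ k ∈ K (m + 1), ‖k‖ ≤ R := by
    refine exists_norm_le_of_inner_bddAbove hS (fun x hx => hx.1) fun y hy => ?_
    have hy' : -y ∈ coneGen (ContinuousLinearMap.adjoint L '' effDom (fconj g) -
        effDom (fconj f)) := by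
      rw [hcone]; exact S.neg_mem hy
    obtain ⟨d, hd, _, ⟨_, ⟨p, hp, rfl⟩, q, hq, rfl⟩, hyd⟩ := hy'
    obtain ⟨c₁, h₁⟩ := (mem_effDom_fconj_iff hf.1.1).1 hq
    obtain ⟨c₂, h₂⟩ := (mem_effDom_fconj_iff hg.1.1).1 hp
    refine ⟨d * (c₁ + c₂ + (m + 1) - ⟪z, p⟫), fun k hk => ?_⟩
    obtain ⟨s, t, hs, ht, hst⟩ := (hsplit k _).1 hk.2
    have h1 := h₁ k s hs
    have h2 := h₂ _ t ht
    rw [inner_sub_left, ← ContinuousLinearMap.adjoint_inner_right] at h2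
    have hky : ⟪k, y⟫ = d * (⟪k, q⟫ - ⟪k, ContinuousLinearMap.adjoint L p⟫) := by
      rw [← neg_neg y, hyd, inner_neg_right, inner_smul_right]
      simp only [inner_sub_right]
      ring
    rw [hky]
    exact mul_le_mul_of_nonneg_left (by linarith) hd
  have hpos : ∀ n : ℕ, (0 : ℝ) < 1 / ((n : ℝ) + 1) := fun n => Nat.one_div_pos_of_nat
  obtain ⟨x, hx⟩ := nonempty_iInter_of_antitone_convex_bounded
    (K := fun n : ℕ => K (m + 1 / ((n : ℝ) + 1)))
    (fun i j hij x hx => ⟨hx.1, hx.2.trans (by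
      have := Nat.one_div_le_one_div (α := ℝ) hij
      exact_mod_cast add_le_add_right this m)⟩)
    (fun n => hne _ (by linarith [hpos n])) (fun n => hclosed _) (fun n => hconv _)
    (R := R) (by simpa using hR)
  refine ⟨x, EReal.le_of_forall_lt_iff_le.1 fun c hc => ?_⟩
  obtain ⟨n, hn⟩ := exists_nat_one_div_lt (sub_pos.2 (EReal.coe_lt_coe_iff.1 hc))
  exact (Set.mem_iInter.1 hx n).2.trans (by exact_mod_cast (by linarith : m + 1 / ((n : ℝ) + 1) ≤ c))

theorem infConv_infPost_le {H G : Type*} [NormedAddCommGroup H] [NormedSpace ℝ H]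
    [NormedAddCommGroup G] [NormedSpace ℝ G] (f : H → EReal) (g : G → EReal) (L : H →L[ℝ] G)
    (x : H) (y : G) : infConv (infPost L f) g (L x + y) ≤ f x + g y :=
  (iInf_le _ y).trans (add_le_add (iInf_le_of_le ⟨x, by simp⟩ le_rfl) le_rfl)

/-- If `dom g*` meets the preimage of `dom f*` under `L*`, then `(L ▷ f) □ g` is nowhere `⊥` and its
value at `z` is approached by the values `f x + g (z - L x)`. -/
theorem infConv_infPost_ne_bot_and_exists_add_le {H G : Type*}
    [NormedAddCommGroup H] [InnerProductSpace ℝ H] [CompleteSpace H]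
    [NormedAddCommGroup G] [InnerProductSpace ℝ G] [CompleteSpace G]
    {f : H → EReal} {g : G → EReal} {L : H →L[ℝ] G}
    (hf : ∀ x, f x ≠ ⊥) (hg : ∀ y, g y ≠ ⊥) {p : G} (hp : p ∈ effDom (fconj g))
    (hLp : ContinuousLinearMap.adjoint L p ∈ effDom (fconj f)) (z : G) :
    infConv (infPost L f) g z ≠ ⊥ ∧
      ∀ c : ℝ, infConv (infPost L f) g z < c → ∃ x, f x + g (z - L x) ≤ c := by
  obtain ⟨c₁, h₁⟩ := (mem_effDom_fconj_iff hf).1 hLp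
  obtain ⟨c₂, h₂⟩ := (mem_effDom_fconj_iff hg).1 hp
  have hpost : ∀ y, infPost L f y ≠ ⊥ := by
    refine fun y => ne_bot_of_le_ne_bot (EReal.coe_ne_bot (⟪y, p⟫ - c₁)) (le_iInf ?_)
    rintro ⟨x, rfl⟩
    refine EReal.le_of_forall_lt_iff_le.1 fun t ht => ?_
    have := h₁ x t ht.le
    rw [ContinuousLinearMap.adjoint_inner_right] at this
    exact_mod_cast (by linarith : ⟪L x, p⟫ - c₁ ≤ t)
  have happrox : ∀ c : ℝ, infConv (infPost L f) g z < c → ∃ x, f x + g (z - L x) ≤ c := by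
    intro c hc
    obtain ⟨y, hy⟩ := iInf_lt_iff.1 hc
    have hgy : g y ≠ ⊤ := fun h => by
      rw [h, EReal.add_top_of_ne_bot (hpost _)] at hy
      exact not_top_lt hy
    have hlt : infPost L f (z - y) < c - g y :=
      (EReal.lt_sub_iff_add_lt (Or.inl (hg y)) (Or.inl hgy)).2 hy
    obtain ⟨⟨x, hx⟩, hxlt⟩ := iInf_lt_iff.1 hlt
    refine ⟨x, ?_⟩
    rw [hx, sub_sub_cancel]
    exact ((EReal.lt_sub_iff_add_lt (Or.inl (hg y)) (Or.inl hgy)).1 hxlt).le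
  refine ⟨fun hz => ?_, happrox⟩
  obtain ⟨x, hx⟩ := happrox (⟪z, p⟫ - c₁ - c₂ - 1) (hz ▸ EReal.bot_lt_coe _)
  obtain ⟨s, t, hs, ht, hst⟩ := (EReal.add_le_coe_iff (hf x) (hg _)).1 hx
  have h1 := h₁ x s hs
  have h2 := h₂ _ t ht
  rw [ContinuousLinearMap.adjoint_inner_right] at h1
  rw [inner_sub_left] at h2
  linarith

/-- `∂((L ▷ f) □ g) = (L ▷ ∂f) □ ∂g` under the qualification
`0 ∈ sri(L*(dom g*) − dom f*)`. -/
theorem subdiff_infConv_infPost {H G : Type*}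
    [NormedAddCommGroup H] [InnerProductSpace ℝ H] [CompleteSpace H]
    [NormedAddCommGroup G] [InnerProductSpace ℝ G] [CompleteSpace G]
    (f : H → EReal) (g : G → EReal) (L : H →L[ℝ] G)
    (hf : IsGamma0 f) (hg : IsGamma0 g)
    (hq : sriMem (ContinuousLinearMap.adjoint L '' effDom (fconj g) - effDom (fconj f)) 0) :
    subdiffFn (infConv (infPost L f) g) =
      parSum (parComp L (subdiffFn f)) (subdiffFn g) := by
  funext z
  ext v
  obtain ⟨_, ⟨p, hp, rfl⟩, q, hqf, hpq⟩ := hq.1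
  obtain rfl : ContinuousLinearMap.adjoint L p = q := sub_eq_zero.1 hpq
  constructor
  · intro hv
    obtain ⟨hbot, happrox⟩ := infConv_infPost_ne_bot_and_exists_add_le hf.1.1 hg.1.1 hp hqf z
    have hv' : ∀ x y, infConv (infPost L f) g z + ((⟪L x + y - z, v⟫ : ℝ) : EReal) ≤ f x + g y :=
      fun x y => (hv _).trans (infConv_infPost_le f g L x y)
    have htop : infConv (infPost L f) g z ≠ ⊤ := by
      obtain ⟨x, hx⟩ := hf.1.2
      obtain ⟨y, hy⟩ := hg.1.2
      intro h
      have := hv' x y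
      rw [h, EReal.top_add_coe] at this
      exact EReal.add_ne_top hx hy (top_le_iff.1 this)
    lift infConv (infPost L f) g z to ℝ using ⟨htop, hbot⟩ with m
    obtain ⟨x, hx⟩ := exists_add_le_of_sriMem hf hg hq
      (fun c hc => happrox c (EReal.coe_lt_coe_iff.2 hc))
    obtain ⟨s, t, hs, ht, hst⟩ := (EReal.add_le_coe_iff (hf.1.1 x) (hg.1.1 _)).1 hx
    have key : ∀ x' y' (s' t' : ℝ), f x' ≤ s' → g y' ≤ t' →
        s + t + ⟪L x' + y' - z, v⟫ ≤ s' + t' := by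
      intro x' y' s' t' hs' ht'
      have h : m + ⟪L x' + y' - z, v⟫ ≤ s' + t' := by
        exact_mod_cast (hv' x' y').trans (add_le_add hs' ht')
      linarith
    refine ⟨L x, ⟨x, fun x' => ?_, rfl⟩, z - L x, fun y' => ?_, add_sub_cancel _ _⟩
    · refine EReal.le_of_forall_lt_iff_le.1 fun s' hs' => ?_
      have h := key x' (z - L x) s' t hs'.le ht
      rw [show L x' + (z - L x) - z = L (x' - x) by rw [map_sub]; abel] at h
      rw [ContinuousLinearMap.adjoint_inner_right]
      exact (add_le_add hs le_rfl).trans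
        (by exact_mod_cast (by linarith : s + ⟪L (x' - x), v⟫ ≤ s'))
    · refine EReal.le_of_forall_lt_iff_le.1 fun t' ht' => ?_
      have h := key x y' s t' hs ht'.le
      rw [show L x + y' - z = y' - (z - L x) by abel] at h
      exact (add_le_add ht le_rfl).trans
        (by exact_mod_cast (by linarith : t + ⟪y' - (z - L x), v⟫ ≤ t'))
  · rintro ⟨_, ⟨x, hx, rfl⟩, y, hy, rfl⟩ w
    refine EReal.le_of_forall_lt_iff_le.1 fun c hc => ?_
    obtain ⟨x', hx'⟩ :=
      (infConv_infPost_ne_bot_and_exists_add_le hf.1.1 hg.1.1 hp hqf w).2 c hc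
    refine le_trans ?_ hx'
    have h1 := hx x'
    have h2 := hy (w - L x')
    rw [ContinuousLinearMap.adjoint_inner_right] at h1
    refine (add_le_add (infConv_infPost_le f g L x y) le_rfl).trans
      (le_trans (le_of_eq ?_) (add_le_add h1 h2))
    have hw : L (x' - x) + (w - L x' - y) = w - (L x + y) := by rw [map_sub]; abel
    rw [add_add_add_comm, ← EReal.coe_add, ← inner_add_left, hw]
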